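/- Let d ≥ 1 and let R (respectively, disjoint R and B) be finite subset(s) of ℝ^d such that all distances between pairs of distinct points (of opposite colours, in the 2-colour case) are pairwise distinct. Then there is a unique ∞-minimal matching M, and there exists μ_0 < ∞ such that for all μ > μ_0, M is the unique μ-minimal matching. Likewise there is a unique (−∞)-minimal matching M', and there exists μ_1 > −∞ such that for all μ < μ_1, M' is the unique μ-minimal matching. -/

import Mathlib

open Set

/-- The cost function `f_γ`. -/
noncomputable def fgam (γ x : ℝ) : ℝ :=
  if 0 < γ then x ^ γ else if γ = 0 then Real.log x else -(x ^ γ)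

variable {α : Type*} [MetricSpace α]

/-- The length of an unordered pair of points. -/
noncomputable def edgeLen : Sym2 α → ℝ :=
  Sym2.lift ⟨fun x y => dist x y, fun x y => dist_comm x y⟩

/-- `M` is a 1-colour (partial) matching of `R`. -/
def IsMatch1 (R : Set α) (M : Set (Sym2 α)) : Prop :=
  (∀ e ∈ M, ¬ e.IsDiag ∧ ∀ x ∈ e, x ∈ R) ∧
  (∀ e ∈ M, ∀ e' ∈ M, ∀ x : α, x ∈ e → x ∈ e' → e = e')

/-- `x` is matched in the 1-colour matching `M`. -/
def matched1 (M : Set (Sym2 α)) (x : α) : Prop := ∃ e ∈ M, x ∈ e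

/-- Number of unmatched points of `R` in `M`. -/
noncomputable def unm1 (R : Set α) (M : Set (Sym2 α)) : ℕ :=
  {x ∈ R | ¬ matched1 M x}.ncard

/-- The total cost of a 1-colour matching. -/
noncomputable def cost1 (f : ℝ → ℝ) (M : Set (Sym2 α)) : ℝ :=
  ∑ᶠ e ∈ M, f (edgeLen e)

/-- Lexicographic comparison of (number of unmatched points, cost). -/
def lexLe (u : ℕ) (c : ℝ) (u' : ℕ) (c' : ℝ) : Prop :=
  u < u' ∨ (u = u' ∧ c ≤ c')

/-- `M` is an `f`-minimal 1-colour matching of the finite set `R`. -/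
def FinMin1 (f : ℝ → ℝ) (R : Set α) (M : Set (Sym2 α)) : Prop :=
  IsMatch1 R M ∧
  ∀ m : Set (Sym2 α), IsMatch1 R m →
    lexLe (unm1 R M) (cost1 f M) (unm1 R m) (cost1 f m)

/-- `M` is a 2-colour (partial) matching of `R` and `B`. -/
def IsMatch2 (R B : Set α) (M : Set (α × α)) : Prop :=
  (∀ e ∈ M, e.1 ∈ R ∧ e.2 ∈ B) ∧
  (∀ x y y' : α, (x, y) ∈ M → (x, y') ∈ M → y = y') ∧
  (∀ x x' y : α, (x, y) ∈ M → (x', y) ∈ M → x = x')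

/-- Number of unmatched points in a 2-colour matching. -/
noncomputable def unm2 (R B : Set α) (M : Set (α × α)) : ℕ :=
  {x ∈ R | ¬ ∃ y, (x, y) ∈ M}.ncard + {y ∈ B | ¬ ∃ x, (x, y) ∈ M}.ncard

/-- The total cost of a 2-colour matching. -/
noncomputable def cost2 (f : ℝ → ℝ) (M : Set (α × α)) : ℝ :=
  ∑ᶠ e ∈ M, f (dist e.1 e.2)

/-- `M` is an `f`-minimal 2-colour matching of the finite sets `R`, `B`. -/
def FinMin2 (f : ℝ → ℝ) (R B : Set α) (M : Set (α × α)) : Prop :=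
  IsMatch2 R B M ∧
  ∀ m : Set (α × α), IsMatch2 R B m →
    lexLe (unm2 R B M) (cost2 f M) (unm2 R B m) (cost2 f m)

/-- `R'` is compatible with the 1-colour matching `M`. -/
def Compat1 (M : Set (Sym2 α)) (R' : Set α) : Prop :=
  ∀ e ∈ M, (∃ x ∈ e, x ∈ R') → ∀ y ∈ e, y ∈ R'

/-- Restriction of a 1-colour matching to a subset of points. -/
def restr1 (M : Set (Sym2 α)) (R' : Set α) : Set (Sym2 α) :=
  {e ∈ M | ∀ x ∈ e, x ∈ R'}

/-- `M` is an `f`-minimal 1-colour matching of a (possibly infinite) set `R`. -/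
def Min1 (f : ℝ → ℝ) (R : Set α) (M : Set (Sym2 α)) : Prop :=
  IsMatch1 R M ∧
  ∀ R' : Set α, R' ⊆ R → R'.Finite → Compat1 M R' → FinMin1 f R' (restr1 M R')

/-- `(R', B')` is compatible with the 2-colour matching `M`. -/
def Compat2 (M : Set (α × α)) (R' B' : Set α) : Prop :=
  ∀ e ∈ M, (e.1 ∈ R' ∨ e.2 ∈ B') → (e.1 ∈ R' ∧ e.2 ∈ B')

/-- Restriction of a 2-colour matching. -/
def restr2 (M : Set (α × α)) (R' B' : Set α) : Set (α × α) :=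
  {e ∈ M | e.1 ∈ R' ∧ e.2 ∈ B'}

/-- `M` is an `f`-minimal 2-colour matching of possibly infinite sets `R`, `B`. -/
def Min2 (f : ℝ → ℝ) (R B : Set α) (M : Set (α × α)) : Prop :=
  IsMatch2 R B M ∧
  ∀ R' B' : Set α, R' ⊆ R → B' ⊆ B → R'.Finite → B'.Finite →
    Compat2 M R' B' → FinMin2 f R' B' (restr2 M R' B')

open Classical in
noncomputable def lens1 (M : Set (Sym2 α)) : Multiset ℝ :=
  if h : M.Finite then h.toFinset.val.map edgeLen else 0

open Classical in
noncomputable def lens2 (M : Set (α × α)) : Multiset ℝ :=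
  if h : M.Finite then h.toFinset.val.map (fun e => dist e.1 e.2) else 0

/-- Increasing rearrangement of a multiset of reals, padded with `⊥ = -∞`. -/
noncomputable def incSeq (s : Multiset ℝ) : ℕ → EReal := fun n =>
  ((s.sort (· ≤ ·)).map (fun x : ℝ => (x : EReal))).getD n ⊥

/-- Decreasing rearrangement of a multiset of reals, padded with `⊥ = -∞`. -/
noncomputable def decSeq (s : Multiset ℝ) : ℕ → EReal := fun n =>
  ((s.sort (· ≤ ·)).reverse.map (fun x : ℝ => (x : EReal))).getD n ⊥

/-- Lexicographic (non-strict) comparison of sequences. -/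
def seqLex (a b : ℕ → EReal) : Prop :=
  a = b ∨ ∃ n : ℕ, (∀ m : ℕ, m < n → a m = b m) ∧ a n < b n

/-- Lexicographic comparison of (number of unmatched points, length sequence). -/
def lexSeqLe (u : ℕ) (a : ℕ → EReal) (u' : ℕ) (b : ℕ → EReal) : Prop :=
  u < u' ∨ (u = u' ∧ seqLex a b)

/-- `M` is a `(-∞)`-minimal 1-colour matching of the finite set `R`. -/
def FinNegMin1 (R : Set α) (M : Set (Sym2 α)) : Prop :=
  IsMatch1 R M ∧ ∀ m : Set (Sym2 α), IsMatch1 R m →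
    lexSeqLe (unm1 R M) (incSeq (lens1 M)) (unm1 R m) (incSeq (lens1 m))

/-- `M` is an `∞`-minimal 1-colour matching of the finite set `R`. -/
def FinPosMin1 (R : Set α) (M : Set (Sym2 α)) : Prop :=
  IsMatch1 R M ∧ ∀ m : Set (Sym2 α), IsMatch1 R m →
    lexSeqLe (unm1 R M) (decSeq (lens1 M)) (unm1 R m) (decSeq (lens1 m))

/-- `M` is a `(-∞)`-minimal 2-colour matching of the finite sets `R`, `B`. -/
def FinNegMin2 (R B : Set α) (M : Set (α × α)) : Prop :=
  IsMatch2 R B M ∧ ∀ m : Set (α × α), IsMatch2 R B m →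
    lexSeqLe (unm2 R B M) (incSeq (lens2 M)) (unm2 R B m) (incSeq (lens2 m))

/-- `M` is an `∞`-minimal 2-colour matching of the finite sets `R`, `B`. -/
def FinPosMin2 (R B : Set α) (M : Set (α × α)) : Prop :=
  IsMatch2 R B M ∧ ∀ m : Set (α × α), IsMatch2 R B m →
    lexSeqLe (unm2 R B M) (decSeq (lens2 M)) (unm2 R B m) (decSeq (lens2 m))

/-- `M` is a `(-∞)`-minimal 1-colour matching of a (possibly infinite) set `R`. -/
def NegMin1 (R : Set α) (M : Set (Sym2 α)) : Prop :=
  IsMatch1 R M ∧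
  ∀ R' : Set α, R' ⊆ R → R'.Finite → Compat1 M R' → FinNegMin1 R' (restr1 M R')

/-- `M` is a `(-∞)`-minimal 2-colour matching of possibly infinite `R`, `B`. -/
def NegMin2 (R B : Set α) (M : Set (α × α)) : Prop :=
  IsMatch2 R B M ∧
  ∀ R' B' : Set α, R' ⊆ R → B' ⊆ B → R'.Finite → B'.Finite →
    Compat2 M R' B' → FinNegMin2 R' B' (restr2 M R' B')

/-- `x` lies strictly between `a` and `b`. -/
def btw (a b x : ℝ) : Prop := min a b < x ∧ x < max a b

/-- The four reals are pairwise distinct. -/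
def distinct4 (a b c d : ℝ) : Prop :=
  a ≠ b ∧ a ≠ c ∧ a ≠ d ∧ b ≠ c ∧ b ≠ d ∧ c ≠ d

/-- The edges `{a,b}` and `{c,d}` are entwined. -/
def EntwinedP (a b c d : ℝ) : Prop :=
  distinct4 a b c d ∧ Xor' (btw a b c) (btw a b d)

/-- The edge `{a,b}` straddles the edge `{c,d}`. -/
def StraddleP (a b c d : ℝ) : Prop := btw a b c ∧ btw a b d

/-- `M` is a `(1+)`-minimal 1-colour matching of a finite set `R ⊂ ℝ`. -/
def OnePlusMin1 (R : Set ℝ) (M : Set (Sym2 ℝ)) : Prop :=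
  FinMin1 (fgam 1) R M ∧
  ∀ a b a' b' : ℝ, s(a, b) ∈ M → s(a', b') ∈ M → ¬ StraddleP a b a' b'

/-- `M` is a `(1-)`-minimal 1-colour matching of a finite set `R ⊂ ℝ`. -/
def OneMinusMin1 (R : Set ℝ) (M : Set (Sym2 ℝ)) : Prop :=
  FinMin1 (fgam 1) R M ∧
  ∀ a b a' b' : ℝ, s(a, b) ∈ M → s(a', b') ∈ M → ¬ EntwinedP a b a' b'

/-- `M` is a `(1+)`-minimal 2-colour matching of finite sets `R, B ⊂ ℝ`. -/
def OnePlusMin2 (R B : Set ℝ) (M : Set (ℝ × ℝ)) : Prop :=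
  FinMin2 (fgam 1) R B M ∧
  ∀ e ∈ M, ∀ e' ∈ M, ¬ StraddleP e.1 e.2 e'.1 e'.2

/-- `M` is a `(1-)`-minimal 2-colour matching of finite sets `R, B ⊂ ℝ`. -/
def OneMinusMin2 (R B : Set ℝ) (M : Set (ℝ × ℝ)) : Prop :=
  FinMin2 (fgam 1) R B M ∧
  ∀ e ∈ M, ∀ e' ∈ M, ¬ EntwinedP e.1 e.2 e'.1 e'.2

lemma list_split {r : ℝ → ℝ → Prop} (irr : ∀ x, ¬ r x x) (tr : ∀ x y z, r x y → r y z → r x z)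
    (tri : ∀ x y, x ≠ y → r x y ∨ r y x) (x : ℝ) :
    ∀ a b : List ℝ, a.Pairwise r → b.Pairwise r → a.length = b.length → x ∈ a → x ∉ b →
      (∀ y, r y x → (y ∈ a ↔ y ∈ b)) →
      ∃ p s z t, a = p ++ x :: s ∧ b = p ++ z :: t ∧ r x z := by
  intro a
  induction a with
  | nil => intro b _ _ _ h; simp at h
  | cons h t ih =>
    intro b ha hb hl hx hxb hag
    cases b with
    | nil => simp at hl
    | cons k s =>
      rw [List.pairwise_cons] at ha hb
      have hxk : x ≠ k := fun h => hxb (by simp [h])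
      by_cases hhx : h = x
      · subst hhx
        refine ⟨[], t, k, s, rfl, rfl, ?_⟩
        rcases tri h k hxk with h1 | h1
        · exact h1
        · have := (hag k h1).2 (by simp)
          rcases List.mem_cons.1 this with h2 | h2
          · exact absurd h2.symm hxk
          · exact absurd (tr _ _ _ h1 (ha.1 _ h2)) (irr _)
      · have hxt : x ∈ t := by
          rcases List.mem_cons.1 hx with h2 | h2
          · exact absurd h2.symm hhx
          · exact h2
        have hr : r h x := ha.1 _ hxt
        have hhb := (hag h hr).1 (by simp)
        have hkh : k = h := by
          rcases List.mem_cons.1 hhb with h2 | h2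
          · exact h2.symm
          · have h3 := hb.1 _ h2
            have := (hag k (tr _ _ _ h3 hr)).2 (by simp)
            rcases List.mem_cons.1 this with h4 | h4
            · exact h4
            · exact absurd (tr _ _ _ h3 (ha.1 _ h4)) (irr _)
        subst hkh
        obtain ⟨p, s', z, t', e1, e2, e3⟩ := ih s ha.2 hb.2 (by simpa using hl) hxt
          (fun h => hxb (by simp [h])) (by
            intro y hy
            have := hag y hy
            simp only [List.mem_cons] at this
            constructor
            · intro h1
              rcases this.1 (Or.inr h1) with h2 | h2
              · exact absurd (h2 ▸ ha.1 _ h1) (irr _)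
              · exact h2
            · intro h1
              rcases this.2 (Or.inr h1) with h2 | h2
              · exact absurd (h2 ▸ hb.1 _ h1) (irr _)
              · exact h2)
        exact ⟨k :: p, s', z, t', by simp [e1], by simp [e2], e3⟩

def sltSeq (a b : ℕ → EReal) : Prop := ∃ n : ℕ, (∀ m : ℕ, m < n → a m = b m) ∧ a n < b n

lemma sltSeq_asymm {a b : ℕ → EReal} (h : sltSeq a b) : ¬ seqLex b a := by
  obtain ⟨n, h1, h2⟩ := h
  rintro (h3 | ⟨m, h3, h4⟩)
  · rw [h3] at h2; exact lt_irrefl _ h2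
  · rcases lt_trichotomy n m with h | h | h
    · rw [h3 n h] at h2; exact lt_irrefl _ h2
    · subst h; exact lt_asymm h2 h4
    · rw [h1 m h] at h4; exact lt_irrefl _ h4

lemma list_slt (p s t : List ℝ) (x z : ℝ) (h : x < z) :
    sltSeq (fun n => ((p ++ x :: s).map (fun x : ℝ => (x : EReal))).getD n ⊥)
      (fun n => ((p ++ z :: t).map (fun x : ℝ => (x : EReal))).getD n ⊥) := by
  refine ⟨p.length, ?_, ?_⟩
  · intro m hm
    simp [List.getD_eq_getElem?_getD, List.getElem?_append, hm]
  · simp [List.getD_eq_getElem?_getD, List.getElem?_append, h]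

lemma inc_slt (A B : Finset ℝ) (hc : A.card = B.card) (x : ℝ) (hx : x ∈ A) (hxb : x ∉ B)
    (hag : ∀ y, y < x → (y ∈ A ↔ y ∈ B)) : sltSeq (incSeq A.val) (incSeq B.val) := by
  obtain ⟨p, s, z, t, e1, e2, e3⟩ := list_split (r := (· < ·)) (fun x => lt_irrefl x)
    (fun _ _ _ => lt_trans) (fun x y h => lt_or_gt_of_ne h) x (A.val.sort (· ≤ ·)) (B.val.sort (· ≤ ·))
    (A.sortedLT_sort.pairwise) (B.sortedLT_sort.pairwise) (by simpa using hc) (by simpa using hx) (by simpa using hxb)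
    (by simpa using hag)
  unfold incSeq
  rw [e1, e2]
  exact list_slt _ _ _ _ _ e3

lemma dec_slt (A B : Finset ℝ) (hc : A.card = B.card) (x : ℝ) (hx : x ∈ A) (hxb : x ∉ B)
    (hag : ∀ y, x < y → (y ∈ A ↔ y ∈ B)) : sltSeq (decSeq B.val) (decSeq A.val) := by
  obtain ⟨p, s, z, t, e1, e2, e3⟩ := list_split (r := (· > ·)) (fun x => lt_irrefl x)
    (fun _ _ _ h1 h2 => lt_trans h2 h1) (fun x y h => (lt_or_gt_of_ne h).symm) x
    (A.val.sort (· ≤ ·)).reverse (B.val.sort (· ≤ ·)).reverse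
    (List.pairwise_reverse.2 A.sortedLT_sort.pairwise) (List.pairwise_reverse.2 B.sortedLT_sort.pairwise)
    (by simpa using hc) (by simpa using hx) (by simpa using hxb)
    (by simpa using hag)
  unfold decSeq
  rw [e1, e2]
  exact list_slt _ _ _ _ _ e3

lemma sum_dom (l : Filter ℝ) (D : Finset ℝ) (x : ℝ) (hx : 0 < x) (hD : ∀ y ∈ D, 0 < y)
    (ht : ∀ y ∈ D, Filter.Tendsto (fun μ : ℝ => (y / x) ^ μ) l (nhds 0)) :
    ∀ᶠ μ in l, ∑ y ∈ D, y ^ μ < x ^ μ := by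
  have h : Filter.Tendsto (fun μ : ℝ => ∑ y ∈ D, (y / x) ^ μ) l (nhds 0) := by
    simpa using tendsto_finsetSum D ht
  filter_upwards [h.eventually (gt_mem_nhds zero_lt_one)] with μ hμ
  have hp : 0 < x ^ μ := Real.rpow_pos_of_pos hx μ
  have : ∑ y ∈ D, (y / x) ^ μ = (∑ y ∈ D, y ^ μ) / x ^ μ := by
    rw [Finset.sum_div]
    exact Finset.sum_congr rfl fun y hy => Real.div_rpow (hD y hy).le hx.le μ
  rw [this, div_lt_one hp] at hμ
  exact hμ

lemma sum_cmp (l : Filter ℝ) (A B : Finset ℝ) (hA : ∀ y ∈ A, 0 < y) (hB : ∀ y ∈ B, 0 < y)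
    (x : ℝ) (hx : x ∈ A) (hxb : x ∉ B)
    (ht : ∀ y ∈ B \ A, Filter.Tendsto (fun μ : ℝ => (y / x) ^ μ) l (nhds 0)) :
    ∀ᶠ μ in l, ∑ y ∈ B, y ^ μ < ∑ y ∈ A, y ^ μ := by
  filter_upwards [sum_dom l (B \ A) x (hA x hx) (fun y hy => hB y (Finset.mem_sdiff.1 hy).1) ht]
    with μ hμ
  rw [← Finset.sum_sdiff_lt_sum_sdiff]
  refine hμ.trans_le ?_
  exact Finset.single_le_sum (f := fun y : ℝ => y ^ μ)
    (fun y hy => (Real.rpow_pos_of_pos (hA y (Finset.mem_sdiff.1 hy).1) μ).le)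
    (Finset.mem_sdiff.2 ⟨hx, hxb⟩)

lemma pos_cmp (A B : Finset ℝ) (hc : A.card = B.card) (hA : ∀ y ∈ A, 0 < y) (hB : ∀ y ∈ B, 0 < y)
    (x : ℝ) (hx : x ∈ A) (hxb : x ∉ B) (hag : ∀ y, x < y → (y ∈ A ↔ y ∈ B)) :
    sltSeq (decSeq B.val) (decSeq A.val) ∧
    ∀ᶠ μ in Filter.atTop, ∑ y ∈ B, fgam μ y < ∑ y ∈ A, fgam μ y := by
  refine ⟨dec_slt A B hc x hx hxb hag, ?_⟩
  have h0 := hA x hx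
  filter_upwards [Filter.eventually_gt_atTop 0, sum_cmp Filter.atTop A B hA hB x hx hxb (by
    intro y hy
    rw [Finset.mem_sdiff] at hy
    have hy0 := hB y hy.1
    have : y < x := by
      rcases lt_trichotomy y x with h | h | h
      · exact h
      · exact absurd (h ▸ hx) hy.2
      · exact absurd ((hag y h).2 hy.1) hy.2
    exact tendsto_rpow_atTop_of_base_lt_one _ (by have := div_pos hy0 h0; linarith)
      ((div_lt_one h0).2 this))] with μ h1 h2
  simpa [fgam, h1] using h2

lemma neg_cmp (A B : Finset ℝ) (hc : A.card = B.card) (hA : ∀ y ∈ A, 0 < y) (hB : ∀ y ∈ B, 0 < y)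
    (x : ℝ) (hx : x ∈ A) (hxb : x ∉ B) (hag : ∀ y, y < x → (y ∈ A ↔ y ∈ B)) :
    sltSeq (incSeq A.val) (incSeq B.val) ∧
    ∀ᶠ μ in Filter.atBot, ∑ y ∈ A, fgam μ y < ∑ y ∈ B, fgam μ y := by
  refine ⟨inc_slt A B hc x hx hxb hag, ?_⟩
  have h0 := hA x hx
  filter_upwards [Filter.eventually_lt_atBot 0, sum_cmp Filter.atBot A B hA hB x hx hxb (by
    intro y hy
    rw [Finset.mem_sdiff] at hy
    have hy0 := hB y hy.1
    have : x < y := by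
      rcases lt_trichotomy x y with h | h | h
      · exact h
      · exact absurd (h ▸ hx) hy.2
      · exact absurd ((hag y h).2 hy.1) hy.2
    exact tendsto_rpow_atBot_of_base_gt_one _ 
      ((one_lt_div h0).2 this))] with μ h1 h2
  simpa [fgam, h1.not_gt, h1.ne] using h2

lemma pos_tri (A B : Finset ℝ) (hne : A ≠ B) (hc : A.card = B.card) (hA : ∀ y ∈ A, 0 < y)
    (hB : ∀ y ∈ B, 0 < y) :
    (sltSeq (decSeq A.val) (decSeq B.val) ∧
      ∀ᶠ μ in Filter.atTop, ∑ y ∈ A, fgam μ y < ∑ y ∈ B, fgam μ y) ∨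
    (sltSeq (decSeq B.val) (decSeq A.val) ∧
      ∀ᶠ μ in Filter.atTop, ∑ y ∈ B, fgam μ y < ∑ y ∈ A, fgam μ y) := by
  have hn : (symmDiff A B).Nonempty := Finset.symmDiff_nonempty.2 hne
  have hm := Finset.max'_mem _ hn
  have hag : ∀ y, (symmDiff A B).max' hn < y → (y ∈ A ↔ y ∈ B) := by
    intro y hy
    by_contra hcon
    have : y ∈ symmDiff A B := by rw [Finset.mem_symmDiff]; tauto
    exact absurd (Finset.le_max' _ _ this) (not_le.2 hy)
  rcases Finset.mem_symmDiff.1 hm with h | h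
  · exact Or.inr (pos_cmp A B hc hA hB _ h.1 h.2 hag)
  · exact Or.inl (pos_cmp B A hc.symm hB hA _ h.1 h.2 fun y hy => (hag y hy).symm)

lemma neg_tri (A B : Finset ℝ) (hne : A ≠ B) (hc : A.card = B.card) (hA : ∀ y ∈ A, 0 < y)
    (hB : ∀ y ∈ B, 0 < y) :
    (sltSeq (incSeq A.val) (incSeq B.val) ∧
      ∀ᶠ μ in Filter.atBot, ∑ y ∈ A, fgam μ y < ∑ y ∈ B, fgam μ y) ∨
    (sltSeq (incSeq B.val) (incSeq A.val) ∧
      ∀ᶠ μ in Filter.atBot, ∑ y ∈ B, fgam μ y < ∑ y ∈ A, fgam μ y) := by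
  have hn : (symmDiff A B).Nonempty := Finset.symmDiff_nonempty.2 hne
  have hm := Finset.min'_mem _ hn
  have hag : ∀ y, y < (symmDiff A B).min' hn → (y ∈ A ↔ y ∈ B) := by
    intro y hy
    by_contra hcon
    have : y ∈ symmDiff A B := by rw [Finset.mem_symmDiff]; tauto
    exact absurd (Finset.min'_le _ _ this) (not_le.2 hy)
  rcases Finset.mem_symmDiff.1 hm with h | h
  · exact Or.inl (neg_cmp A B hc hA hB _ h.1 h.2 hag)
  · exact Or.inr (neg_cmp B A hc.symm hB hA _ h.1 h.2 fun y hy => (hag y hy).symm)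

lemma core {X : Type*} (P : Set X) (hfin : P.Finite) (hne : P.Nonempty) (u : X → ℕ)
    (sq : X → ℕ → EReal) (l : Filter ℝ) [l.NeBot] (c : ℝ → X → ℝ)
    (h : ∀ A ∈ P, ∀ B ∈ P, A ≠ B → u A = u B →
      (sltSeq (sq A) (sq B) ∧ ∀ᶠ μ in l, c μ A < c μ B) ∨
      (sltSeq (sq B) (sq A) ∧ ∀ᶠ μ in l, c μ B < c μ A)) :
    ∃ M, (M ∈ P ∧ ∀ m, m ∈ P → lexSeqLe (u M) (sq M) (u m) (sq m)) ∧
      (∀ M', (M' ∈ P ∧ ∀ m, m ∈ P → lexSeqLe (u M') (sq M') (u m) (sq m)) → M' = M) ∧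
      ∀ᶠ μ in l, (M ∈ P ∧ ∀ m, m ∈ P → lexLe (u M) (c μ M) (u m) (c μ m)) ∧
        ∀ M', (M' ∈ P ∧ ∀ m, m ∈ P → lexLe (u M') (c μ M') (u m) (c μ m)) → M' = M := by
  have hev : ∀ᶠ μ in l, ∀ A ∈ P, ∀ B ∈ P, A ≠ B → u A = u B →
      (sltSeq (sq A) (sq B) ∧ c μ A < c μ B) ∨ (sltSeq (sq B) (sq A) ∧ c μ B < c μ A) := by
    rw [Filter.eventually_all_finite hfin]
    intro A hA
    rw [Filter.eventually_all_finite hfin]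
    intro B hB
    by_cases hAB : A ≠ B ∧ u A = u B
    · rcases h A hA B hB hAB.1 hAB.2 with h1 | h1
      · filter_upwards [h1.2] with μ hμ _ _ using Or.inl ⟨h1.1, hμ⟩
      · filter_upwards [h1.2] with μ hμ _ _ using Or.inr ⟨h1.1, hμ⟩
    · exact Filter.Eventually.of_forall fun μ h1 h2 => absurd ⟨h1, h2⟩ hAB
  obtain ⟨μ, hμ⟩ := hev.exists
  obtain ⟨M, hM, hmin⟩ := hfin.exists_minimalFor (fun X => toLex (u X, c μ X)) P hne
  have hmin' : ∀ m ∈ P, u M < u m ∨ (u M = u m ∧ c μ M ≤ c μ m) := by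
    intro m hm
    have h2 : toLex (u M, c μ M) ≤ toLex (u m, c μ m) := by
      rcases le_total (toLex (u M, c μ M)) (toLex (u m, c μ m)) with h3 | h3
      · exact h3
      · exact hmin hm h3
    simpa [Prod.Lex.le_iff] using h2
  have key : ∀ m ∈ P, m ≠ M → u M < u m ∨ (u M = u m ∧ sltSeq (sq M) (sq m)) := by
    intro m hm hne
    rcases hmin' m hm with h1 | ⟨h1, h2⟩
    · exact Or.inl h1
    · rcases hμ M hM m hm hne.symm h1 with h3 | h3
      · exact Or.inr ⟨h1, h3.1⟩
      · exact absurd h3.2 (not_lt.2 h2)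
  refine ⟨M, ⟨hM, ?_⟩, ?_, ?_⟩
  · intro m hm
    by_cases hne : m = M
    · exact Or.inr ⟨by rw [hne], Or.inl (by rw [hne])⟩
    · rcases key m hm hne with h1 | ⟨h1, h2⟩
      · exact Or.inl h1
      · exact Or.inr ⟨h1, Or.inr h2⟩
  · rintro M' ⟨hM', h'⟩
    by_contra hne
    rcases key M' hM' hne with h1 | ⟨h1, h2⟩ <;> rcases h' M hM with h3 | ⟨h3, h4⟩
    · omega
    · omega
    · omega
    · exact sltSeq_asymm h2 h4
  · filter_upwards [hev] with ν hν
    have key2 : ∀ m ∈ P, m ≠ M → u M < u m ∨ (u M = u m ∧ c ν M < c ν m) := by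
      intro m hm hne
      rcases key m hm hne with h1 | ⟨h1, h2⟩
      · exact Or.inl h1
      · rcases hν M hM m hm (Ne.symm hne) h1 with h3 | h3
        · exact Or.inr ⟨h1, h3.2⟩
        · exact absurd (Or.inr h3.1) (sltSeq_asymm h2)
    refine ⟨⟨hM, ?_⟩, ?_⟩
    · intro m hm
      by_cases hne : m = M
      · exact Or.inr ⟨by rw [hne], by rw [hne]⟩
      · rcases key2 m hm hne with h1 | ⟨h1, h2⟩
        · exact Or.inl h1
        · exact Or.inr ⟨h1, h2.le⟩
    · rintro M' ⟨hM', h'⟩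
      by_contra hne
      rcases key2 M' hM' hne with h1 | ⟨h1, h2⟩ <;> rcases h' M hM with h3 | ⟨h3, h4⟩
      · omega
      · omega
      · omega
      · exact absurd h2 (not_lt.2 h4)

open Classical in
lemma mid {E : Type*} (len : E → ℝ) (S : Set E) (hS : S.Finite) (inj : Set.InjOn len S)
    (pos : ∀ e ∈ S, 0 < len e) (P : Set (Set E)) (hP : ∀ M ∈ P, M ⊆ S) (h0 : ∅ ∈ P)
    (u : Set E → ℕ) (K : ℕ) (hu : ∀ M ∈ P, u M + 2 * M.ncard = K)
    (lens : Set E → Multiset ℝ)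
    (hlens : ∀ M, lens M = if h : M.Finite then h.toFinset.val.map len else 0)
    (c : ℝ → Set E → ℝ) (hcst : ∀ μ M, c μ M = ∑ᶠ e ∈ M, fgam μ (len e)) :
    (∃ M, (M ∈ P ∧ ∀ m, m ∈ P → lexSeqLe (u M) (decSeq (lens M)) (u m) (decSeq (lens m))) ∧
      (∀ M', (M' ∈ P ∧ ∀ m, m ∈ P → lexSeqLe (u M') (decSeq (lens M')) (u m) (decSeq (lens m))) → M' = M) ∧
      ∃ μ₀ : ℝ, ∀ μ : ℝ, μ₀ < μ → (M ∈ P ∧ ∀ m, m ∈ P → lexLe (u M) (c μ M) (u m) (c μ m)) ∧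
        ∀ M', (M' ∈ P ∧ ∀ m, m ∈ P → lexLe (u M') (c μ M') (u m) (c μ m)) → M' = M) ∧
    (∃ M, (M ∈ P ∧ ∀ m, m ∈ P → lexSeqLe (u M) (incSeq (lens M)) (u m) (incSeq (lens m))) ∧
      (∀ M', (M' ∈ P ∧ ∀ m, m ∈ P → lexSeqLe (u M') (incSeq (lens M')) (u m) (incSeq (lens m))) → M' = M) ∧
      ∃ μ₀ : ℝ, ∀ μ : ℝ, μ < μ₀ → (M ∈ P ∧ ∀ m, m ∈ P → lexLe (u M) (c μ M) (u m) (c μ m)) ∧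
        ∀ M', (M' ∈ P ∧ ∀ m, m ∈ P → lexLe (u M') (c μ M') (u m) (c μ m)) → M' = M) := by
  have hPf : P.Finite := hS.finite_subsets.subset hP
  have hF : ∀ M ∈ P, ∃ A : Finset ℝ, A.val = lens M ∧ A.card = M.ncard ∧ (∀ y ∈ A, 0 < y) ∧
      (∀ μ, c μ M = ∑ y ∈ A, fgam μ y) ∧ (A : Set ℝ) = len '' M := by
    intro M hM
    have hMf : M.Finite := hS.subset (hP M hM)
    have hin : Set.InjOn len M := inj.mono (hP M hM)
    have hin' : Set.InjOn len (hMf.toFinset : Set E) := by simpa using hin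
    refine ⟨hMf.toFinset.image len, ?_, ?_, ?_, ?_, ?_⟩
    · rw [hlens, dif_pos hMf, Finset.image_val_of_injOn hin']
    · rw [Finset.card_image_of_injOn hin', Set.ncard_eq_toFinset_card M hMf]
    · intro y hy
      obtain ⟨e, he, rfl⟩ := Finset.mem_image.1 hy
      exact pos e (hP M hM (by simpa using he))
    · intro μ
      rw [hcst, Finset.sum_image hin', finsum_mem_eq_finite_toFinset_sum _ hMf]
    · simp
  have hne : ∀ M ∈ P, ∀ N ∈ P, len '' M = len '' N → M = N := fun M hM N hN h =>
    (inj.image_eq_image_iff (hP M hM) (hP N hN)).1 h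
  constructor
  · obtain ⟨M, h1, h2, h3⟩ := core P hPf ⟨∅, h0⟩ u (fun M => decSeq (lens M)) Filter.atTop c (by
      intro A hA B hB hAB huAB
      obtain ⟨A', a1, a2, a3, a4, a5⟩ := hF A hA
      obtain ⟨B', b1, b2, b3, b4, b5⟩ := hF B hB
      simp only [← a1, ← b1, a4, b4]
      have := hu A hA
      have := hu B hB
      exact pos_tri A' B' (fun h => hAB (hne A hA B hB (by rw [← a5, ← b5, h]))) (by omega) a3 b3)
    obtain ⟨μ₀, hμ⟩ := Filter.eventually_atTop.1 h3
    exact ⟨M, h1, h2, μ₀, fun μ h => hμ μ h.le⟩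
  · obtain ⟨M, h1, h2, h3⟩ := core P hPf ⟨∅, h0⟩ u (fun M => incSeq (lens M)) Filter.atBot c (by
      intro A hA B hB hAB huAB
      obtain ⟨A', a1, a2, a3, a4, a5⟩ := hF A hA
      obtain ⟨B', b1, b2, b3, b4, b5⟩ := hF B hB
      simp only [← a1, ← b1, a4, b4]
      have := hu A hA
      have := hu B hB
      exact neg_tri A' B' (fun h => hAB (hne A hA B hB (by rw [← a5, ← b5, h]))) (by omega) a3 b3)
    obtain ⟨μ₀, hμ⟩ := Filter.eventually_atBot.1 h3
    exact ⟨M, h1, h2, μ₀, fun μ h => hμ μ h.le⟩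

open Classical in
lemma count1 {β : Type*} [MetricSpace β] (R : Set β) (hR : R.Finite) (M : Set (Sym2 β))
    (hM : IsMatch1 R M) (hMf : M.Finite) : unm1 R M + 2 * M.ncard = R.ncard := by
  have h1 : {x ∈ R | matched1 M x} = ((hMf.toFinset.biUnion fun e => e.toFinset : Finset β) : Set β) := by
    ext x
    simp only [Set.mem_setOf_eq, matched1, Finset.coe_biUnion, Set.mem_iUnion, Finset.mem_coe,
      Set.Finite.mem_toFinset, Sym2.mem_toFinset, exists_prop]
    constructor
    · exact fun h => h.2
    · rintro ⟨e, he, hx⟩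
      exact ⟨(hM.1 e he).2 x hx, e, he, hx⟩
  have h2 : {x ∈ R | matched1 M x}.ncard = 2 * M.ncard := by
    rw [h1, Set.ncard_coe_finset, Finset.card_biUnion, Set.ncard_eq_toFinset_card M hMf,
      Finset.sum_const_nat (m := 2), mul_comm]
    · intro e he
      exact Sym2.card_toFinset_of_not_isDiag e (hM.1 e (by simpa using he)).1
    · intro e he e' he' hne
      rw [Function.onFun, Finset.disjoint_left]
      intro x hx hx'
      exact hne (hM.2 e (by simpa using he) e' (by simpa using he') x (by simpa using hx)
        (by simpa using hx'))
  have h3 := Set.ncard_inter_add_ncard_diff_eq_ncard R {x | matched1 M x} hR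
  have h4 : R ∩ {x | matched1 M x} = {x ∈ R | matched1 M x} := rfl
  have h5 : R \ {x | matched1 M x} = {x ∈ R | ¬ matched1 M x} := rfl
  rw [h4, h5, h2] at h3
  unfold unm1
  omega

lemma count2 {β : Type*} [MetricSpace β] (R B : Set β) (hR : R.Finite) (hB : B.Finite)
    (M : Set (β × β)) (hM : IsMatch2 R B M) :
    unm2 R B M + 2 * M.ncard = R.ncard + B.ncard := by
  have e1 : R ∩ {x | ∃ y, (x, y) ∈ M} = Prod.fst '' M := by
    ext x
    constructor
    · rintro ⟨_, y, hy⟩; exact ⟨_, hy, rfl⟩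
    · rintro ⟨⟨a, b⟩, h, rfl⟩; exact ⟨(hM.1 _ h).1, b, h⟩
  have e2 : B ∩ {y | ∃ x, (x, y) ∈ M} = Prod.snd '' M := by
    ext x
    constructor
    · rintro ⟨_, y, hy⟩; exact ⟨_, hy, rfl⟩
    · rintro ⟨⟨a, b⟩, h, rfl⟩; exact ⟨(hM.1 _ h).2, a, h⟩
  have i1 : Set.InjOn Prod.fst M := by
    rintro ⟨a, b⟩ h ⟨a', b'⟩ h' (rfl : a = a')
    rw [hM.2.1 _ _ _ h h']
  have i2 : Set.InjOn Prod.snd M := by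
    rintro ⟨a, b⟩ h ⟨a', b'⟩ h' (rfl : b = b')
    rw [hM.2.2 _ _ _ h h']
  have h3 := Set.ncard_inter_add_ncard_diff_eq_ncard R {x | ∃ y, (x, y) ∈ M} hR
  have h3' := Set.ncard_inter_add_ncard_diff_eq_ncard B {y | ∃ x, (x, y) ∈ M} hB
  rw [e1, Set.ncard_image_of_injOn i1] at h3
  rw [e2, Set.ncard_image_of_injOn i2] at h3'
  have h5 : R \ {x | ∃ y, (x, y) ∈ M} = {x ∈ R | ¬ ∃ y, (x, y) ∈ M} := rfl
  have h5' : B \ {y | ∃ x, (x, y) ∈ M} = {y ∈ B | ¬ ∃ x, (x, y) ∈ M} := rfl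
  rw [h5] at h3
  rw [h5'] at h3'
  unfold unm2
  omega

/-- For finite set(s) with pairwise distinct distances there is a unique `∞`-minimal
matching, which is the unique `μ`-minimal matching for all sufficiently large `μ`;
likewise for `(-∞)`-minimal matchings and sufficiently negative `μ`
(1-colour and 2-colour cases). -/
theorem stmt_6 (d : ℕ) (hd : 1 ≤ d) :
    (∀ R : Set (EuclideanSpace ℝ (Fin d)), R.Finite →
      (∀ x ∈ R, ∀ y ∈ R, ∀ x' ∈ R, ∀ y' ∈ R, x ≠ y → x' ≠ y' →
        s(x, y) ≠ s(x', y') → dist x y ≠ dist x' y') →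
      (∃ M, FinPosMin1 R M ∧ (∀ M', FinPosMin1 R M' → M' = M) ∧
        ∃ μ₀ : ℝ, ∀ μ : ℝ, μ₀ < μ →
          FinMin1 (fgam μ) R M ∧ ∀ M', FinMin1 (fgam μ) R M' → M' = M) ∧
      (∃ M, FinNegMin1 R M ∧ (∀ M', FinNegMin1 R M' → M' = M) ∧
        ∃ μ₁ : ℝ, ∀ μ : ℝ, μ < μ₁ →
          FinMin1 (fgam μ) R M ∧ ∀ M', FinMin1 (fgam μ) R M' → M' = M)) ∧
    (∀ R B : Set (EuclideanSpace ℝ (Fin d)), R.Finite → B.Finite → Disjoint R B →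
      (∀ x ∈ R, ∀ y ∈ B, ∀ x' ∈ R, ∀ y' ∈ B, (x, y) ≠ (x', y') → dist x y ≠ dist x' y') →
      (∃ M, FinPosMin2 R B M ∧ (∀ M', FinPosMin2 R B M' → M' = M) ∧
        ∃ μ₀ : ℝ, ∀ μ : ℝ, μ₀ < μ →
          FinMin2 (fgam μ) R B M ∧ ∀ M', FinMin2 (fgam μ) R B M' → M' = M) ∧
      (∃ M, FinNegMin2 R B M ∧ (∀ M', FinNegMin2 R B M' → M' = M) ∧
        ∃ μ₁ : ℝ, ∀ μ : ℝ, μ < μ₁ →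
          FinMin2 (fgam μ) R B M ∧ ∀ M', FinMin2 (fgam μ) R B M' → M' = M)) := by
  constructor
  · intro R hR hd
    have hSf : {e : Sym2 (EuclideanSpace ℝ (Fin d)) | ¬ e.IsDiag ∧ ∀ x ∈ e, x ∈ R}.Finite := by
      refine ((hR.prod hR).image (fun p => s(p.1, p.2))).subset ?_
      intro e
      induction e with
      | h x y =>
        rintro ⟨_, h⟩
        exact ⟨(x, y), ⟨h x (by simp), h y (by simp)⟩, rfl⟩
    refine mid edgeLen _ hSf ?_ ?_ {M | IsMatch1 R M} (fun M hM e he => hM.1 e he) ?_ (unm1 R)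
      R.ncard ?_ lens1 (fun M => rfl) (fun μ => cost1 (fgam μ)) (fun μ M => rfl)
    · intro e he e' he'
      induction e with
      | h x y =>
        induction e' with
        | h x' y' =>
          intro h
          by_contra hne
          exact hd x (he.2 x (by simp)) y (he.2 y (by simp)) x' (he'.2 x' (by simp))
            y' (he'.2 y' (by simp)) (fun h => he.1 (by simp [h])) (fun h => he'.1 (by simp [h])) hne h
    · intro e he
      induction e with
      | h x y =>
        have hxy : x ≠ y := fun h => he.1 (by simp [h])
        exact dist_pos.2 hxy
    · exact ⟨by simp, by simp⟩
    · intro M hM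
      exact count1 R hR M hM (hSf.subset fun e he => hM.1 e he)
  · intro R B hR hB hdis hd
    refine mid (fun e => dist e.1 e.2) (R ×ˢ B) (hR.prod hB) ?_ ?_ {M | IsMatch2 R B M}
      (fun M hM e he => hM.1 e he) ?_ (unm2 R B)
      (R.ncard + B.ncard) ?_ lens2 (fun M => rfl) (fun μ => cost2 (fgam μ)) (fun μ M => rfl)
    · rintro ⟨x, y⟩ he ⟨x', y'⟩ he' h
      by_contra hne
      exact hd x he.1 y he.2 x' he'.1 y' he'.2 hne h
    · rintro ⟨x, y⟩ he
      exact dist_pos.2 (fun h => Set.disjoint_left.1 hdis he.1 (by rw [show x = y from h]; exact he.2))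
    · exact ⟨by simp, by simp, by simp⟩
    · intro M hM
      exact count2 R B hR hB M hM
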